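/- If there exists a Sierpiński set, then there exist sets X, Y ⊆ 2^ω such that X and Y are each B-null for every balanced perfect set B, but h[X × Y] is not U-null for some uniformly perfect set U (i.e., X, Y ∈ bPN while X × Y ∉ uPN). -/

import Mathlib

open MeasureTheory Set Pointwise

/-- The Cantor space `2^ω`, a compact topological group under coordinatewise
addition mod 2. -/
abbrev CS := ℕ → ZMod 2

/-- The basic clopen set `[w]` determined by a finite binary sequence `w`:
all `x ∈ 2^ω` extending `w`. -/
def cyl (w : List (ZMod 2)) : Set CS := {x | ∀ i, i < w.length → x i = w.getD i 0}

/-- `w` is a branching node of `P`: both `[w⌢0] ∩ P` and `[w⌢1] ∩ P` are nonempty. -/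
def Branch (P : Set CS) (w : List (ZMod 2)) : Prop :=
  (cyl (w ++ [0]) ∩ P).Nonempty ∧ (cyl (w ++ [1]) ∩ P).Nonempty

/-- A perfect subset of Cantor space: nonempty, closed, with no isolated points. -/
def PerfSet (P : Set CS) : Prop := Perfect P ∧ P.Nonempty

/-- `ν` is a canonical measure of the perfect set `P`: a Borel probability measure with
`ν P = 1` and `ν [w⌢0] = ν [w⌢1]` for every branching node `w` of `P`. -/
def IsCanonical (P : Set CS) (ν : Measure CS) : Prop :=
  IsProbabilityMeasure ν ∧ ν P = 1 ∧
    ∀ w : List (ZMod 2), Branch P w → ν (cyl (w ++ [0])) = ν (cyl (w ++ [1]))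

/-- `A` is `P`-null: the `μ_P`-outer measure of `A ∩ P` is `0`
(quantified over all canonical measures of `P`). -/
def PNull (P A : Set CS) : Prop := ∀ ν : Measure CS, IsCanonical P ν → ν (A ∩ P) = 0

/-- `A` is `P`-measurable: `A ∩ P` differs from a Borel set by a `P`-null set,
i.e. it is null-measurable with respect to the canonical measure of `P`. -/
def PMeasurable (P A : Set CS) : Prop :=
  ∀ ν : Measure CS, IsCanonical P ν → NullMeasurableSet (A ∩ P) ν

/-- `X` is perfectly null: `P`-null for every perfect set `P`. -/
def PerfectlyNull (X : Set CS) : Prop := ∀ P, PerfSet P → PNull P X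

/-- `μ` is the fair-coin (Lebesgue product) measure on `2^ω`:
a Borel probability measure with `μ [w] = 2^{-|w|}` for every finite binary sequence. -/
def IsFairCoin (μ : Measure CS) : Prop :=
  IsProbabilityMeasure μ ∧ ∀ w : List (ZMod 2), μ (cyl w) = (2 : ENNReal)⁻¹ ^ w.length

/-- The number of branching nodes of `P` that are proper initial segments of `v`. -/
noncomputable def brCount (P : Set CS) (v : List (ZMod 2)) : ℕ :=
  Set.ncard {u : List (ZMod 2) | u <+: v ∧ u ≠ v ∧ Branch P u}

/-- A balanced perfect set: branching nodes of strictly smaller level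
are strictly shorter. -/
def BalancedPerf (P : Set CS) : Prop :=
  PerfSet P ∧ ∀ v w : List (ZMod 2), Branch P v → Branch P w →
    brCount P v < brCount P w → v.length < w.length

/-- A uniformly perfect set: on each length, either all nodes meeting `P` branch,
or none does. -/
def UniformlyPerf (P : Set CS) : Prop :=
  PerfSet P ∧ ∀ n : ℕ,
    (∀ w : List (ZMod 2), w.length = n → (cyl w ∩ P).Nonempty → Branch P w) ∨
    (∀ w : List (ZMod 2), w.length = n → ¬ Branch P w)

/-- A Silver perfect set: determined by a partial function `ℕ ⇀ 2`
whose domain has infinite complement. -/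
def SilverPerf (P : Set CS) : Prop :=
  ∃ f : ℕ → Option (ZMod 2), {n | f n = none}.Infinite ∧
    P = {x | ∀ n b, f n = some b → x n = b}

/-- A Marczewski null (`s₀`) set. -/
def S0Set (X : Set CS) : Prop :=
  ∀ P, PerfSet P → ∃ Q, PerfSet Q ∧ Q ⊆ P ∧ Q ∩ X = ∅

/-- `S` is a Sierpiński set with respect to the measure `μ`: uncountable, with
countable intersection with every `μ`-null set. -/
def Sierpinski (μ : Measure CS) (S : Set CS) : Prop :=
  ¬ S.Countable ∧ ∀ N : Set CS, μ N = 0 → (S ∩ N).Countable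

/-- The interleaving homeomorphism `h : 2^ω × 2^ω → 2^ω`,
`h(x,y) = ⟨x 0, y 0, x 1, y 1, …⟩`. -/
def interleave (p : CS × CS) : CS := fun n => if n % 2 = 0 then p.1 (n / 2) else p.2 (n / 2)

/-- `X` is universally null: outer measure zero with respect to every finite diffused
Borel measure on `2^ω`. -/
def UniversallyNull (X : Set CS) : Prop :=
  ∀ μ : Measure CS, IsFiniteMeasure μ → (∀ x : CS, μ {x} = 0) → μ X = 0

/-- `X` is strongly null: for every sequence of positive `ε n` there are sets `A n` of
diameter `< ε n` (with respect to the standard metric `d(x,y) = 2^{-min{n : x n ≠ y n}}`,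
expressed combinatorially) covering `X`. -/
def StronglyNull (X : Set CS) : Prop :=
  ∀ ε : ℕ → ℝ, (∀ n, 0 < ε n) → ∃ A : ℕ → Set CS,
    (∀ n, ∃ N : ℕ, (2 : ℝ)⁻¹ ^ N < ε n ∧ ∀ x ∈ A n, ∀ y ∈ A n, ∀ i < N, x i = y i) ∧
    X ⊆ ⋃ n, A n

/-- `X` is perfectly null in the transitive sense: for every perfect `P` there is a
`G_δ` set `G ⊇ X` with `(G + t) ∩ P` being `P`-null for every `t`. -/
def PNPrime (X : Set CS) : Prop :=
  ∀ P, PerfSet P → ∃ G : Set CS, IsGδ G ∧ X ⊆ G ∧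
    ∀ t : CS, PNull P ((fun g => g + t) '' G)

/-! ### Cylinders and prefixes -/

/-- The restriction of `x` to its first `n` coordinates. -/
def pre (x : CS) (n : ℕ) : List (ZMod 2) := (List.range n).map x

lemma pre_length (x : CS) (n : ℕ) : (pre x n).length = n := by simp [pre]

lemma pre_succ (x : CS) (n : ℕ) : pre x (n + 1) = pre x n ++ [x n] := by
  simp [pre, List.range_succ]

lemma mem_cyl_pre (x y : CS) (n : ℕ) : y ∈ cyl (pre x n) ↔ ∀ i < n, y i = x i := by
  simp only [cyl, mem_ofPred_eq, pre_length]
  refine forall_congr' fun i => forall_congr' fun hi => ?_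
  rw [List.getD_eq_getElem _ _ (by simpa [pre_length] using hi)]
  simp [pre]

lemma self_mem_pre (x : CS) (n : ℕ) : x ∈ cyl (pre x n) := by
  rw [mem_cyl_pre]; intros; rfl

lemma pre_eq_of_mem {x : CS} {w : List (ZMod 2)} (h : x ∈ cyl w) : pre x w.length = w := by
  apply List.ext_getElem (by simp [pre_length])
  intro i h1 h2
  have := h i h2
  rw [List.getD_eq_getElem _ _ h2] at this
  simp [pre, this]

lemma pre_congr {x y : CS} {n : ℕ} (h : ∀ i < n, x i = y i) : pre x n = pre y n := by
  apply List.map_congr_left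
  intro i hi
  exact h i (by simpa using hi)

lemma mem_cyl_snoc (x : CS) (w : List (ZMod 2)) (b : ZMod 2) :
    x ∈ cyl (w ++ [b]) ↔ x ∈ cyl w ∧ x w.length = b := by
  constructor
  · intro h
    have e := pre_eq_of_mem h
    rw [List.length_append, List.length_singleton, pre_succ] at e
    have e2 := List.append_inj e (by simp [pre_length])
    refine ⟨?_, by simpa using e2.2⟩
    have := self_mem_pre x w.length
    rwa [e2.1] at this
  · rintro ⟨h1, h2⟩
    have := self_mem_pre x (w.length + 1)
    rwa [pre_succ, pre_eq_of_mem h1, h2] at this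

lemma cyl_snoc (w : List (ZMod 2)) (b : ZMod 2) :
    cyl (w ++ [b]) = cyl w ∩ {x | x w.length = b} := by
  ext x; exact mem_cyl_snoc x w b

lemma meas_coord (n : ℕ) (b : ZMod 2) : MeasurableSet {x : CS | x n = b} := by
  have : MeasurableSet ((fun x : CS => x n) ⁻¹' {b}) :=
    (measurable_pi_apply n) (measurableSet_singleton b)
  exact this

lemma open_coord (n : ℕ) (b : ZMod 2) : IsOpen {x : CS | x n = b} := by
  have : IsOpen ((fun x : CS => x n) ⁻¹' {b}) :=
    (isOpen_discrete {b}).preimage (continuous_apply n)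
  exact this

lemma cyl_nil : cyl [] = univ := by
  ext x; simp [cyl]

lemma isOpen_cyl (w : List (ZMod 2)) : IsOpen (cyl w) := by
  induction w using List.reverseRecOn with
  | nil => rw [cyl_nil]; exact isOpen_univ
  | append_singleton w b ih => rw [cyl_snoc]; exact ih.inter (open_coord _ _)

lemma meas_cyl (w : List (ZMod 2)) : MeasurableSet (cyl w) := (isOpen_cyl w).measurableSet

lemma cyl_subset_of_isOpen {O : Set CS} (hO : IsOpen O) {x : CS} (hx : x ∈ O) :
    ∃ N, ∀ n ≥ N, cyl (pre x n) ⊆ O := by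
  rw [isOpen_pi_iff] at hO
  obtain ⟨I, u, hu, hs⟩ := hO x hx
  refine ⟨I.sup id + 1, fun n hn y hy => hs ?_⟩
  intro i hi
  rw [mem_cyl_pre] at hy
  have : i ≤ I.sup id := Finset.le_sup (f := id) hi
  rw [hy i (by omega)]
  exact (hu i hi).2

lemma zmod2 (b : ZMod 2) : b = 0 ∨ b = 1 := by
  revert b; decide

/-! ### A density lemma -/

lemma density (ρ : Measure CS) [IsProbabilityMeasure ρ] (G : Set CS) (c : ENNReal) (hc : c < 1)
    (E : Set CS) (hEG : E ⊆ G)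
    (hE : ∀ x ∈ E, ∀ N, ∃ n ≥ N, ρ (cyl (pre x n) ∩ G) ≤ c * ρ (cyl (pre x n))) :
    ρ E = 0 := by
  by_contra h0
  have hfin : ρ E ≠ ⊤ := measure_ne_top _ _
  have key : ∀ δ : ENNReal, δ ≠ 0 → ρ E ≤ c * (ρ E + δ) := by
    intro δ hδ
    obtain ⟨O, hEO, hO, hle⟩ := Set.exists_isOpen_le_add E ρ hδ
    let Q : List (ZMod 2) → Prop := fun w => ρ (cyl w ∩ G) ≤ c * ρ (cyl w) ∧ cyl w ⊆ O
    let W : Set (List (ZMod 2)) := {w | Q w ∧ ∀ x ∈ cyl w, ∀ m < w.length, ¬ Q (pre x m)}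
    have hW : W.PairwiseDisjoint cyl := by
      intro w hw w' hw' hne
      refine Set.disjoint_left.2 fun z hz hz' => hne ?_
      have e := pre_eq_of_mem hz
      have e' := pre_eq_of_mem hz'
      rcases lt_trichotomy w.length w'.length with h | h | h
      · exact absurd (e.symm ▸ hw.1) (hw'.2 z hz' _ h)
      · rw [← e, ← e', h]
      · exact absurd (e'.symm ▸ hw'.1) (hw.2 z hz _ h)
    have hcov : E ⊆ ⋃ w ∈ W, (cyl w ∩ G) := by
      intro x hx
      obtain ⟨N, hN⟩ := cyl_subset_of_isOpen hO (hEO hx)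
      obtain ⟨n, hn, hb⟩ := hE x hx N
      have hex : ∃ n, Q (pre x n) := ⟨n, hb, hN n hn⟩
      classical
      refine mem_iUnion₂.2 ⟨pre x (Nat.find hex), ⟨Nat.find_spec hex, ?_⟩, self_mem_pre _ _, hEG hx⟩
      intro y hy m hm
      rw [pre_length] at hm
      rw [mem_cyl_pre] at hy
      rw [pre_congr (y := x) fun i hi => hy i (by omega)]
      exact Nat.find_min hex hm
    calc ρ E ≤ ρ (⋃ w ∈ W, (cyl w ∩ G)) := measure_mono hcov
      _ ≤ ∑' w : W, ρ (cyl w ∩ G) := measure_biUnion_le ρ W.to_countable _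
      _ ≤ ∑' w : W, c * ρ (cyl w) := ENNReal.tsum_le_tsum fun w => w.2.1.1
      _ = c * ∑' w : W, ρ (cyl w) := ENNReal.tsum_mul_left
      _ = c * ρ (⋃ w ∈ W, cyl w) := by
        rw [measure_biUnion W.to_countable hW fun w _ => meas_cyl w]
      _ ≤ c * ρ O := by
        gcongr
        exact iUnion₂_subset fun w hw => hw.1.2
      _ ≤ c * (ρ E + δ) := by gcongr
  have hlim : ρ E ≤ c * ρ E := by
    have hcont : Filter.Tendsto (fun δ : ENNReal => c * (ρ E + δ)) (nhdsWithin 0 (Ioi 0))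
        (nhds (c * (ρ E + 0))) := by
      apply Filter.Tendsto.mono_left _ nhdsWithin_le_nhds
      apply ENNReal.Tendsto.const_mul
      · exact tendsto_const_nhds.add Filter.tendsto_id
      · right; exact (hc.trans ENNReal.one_lt_top).ne
    rw [add_zero] at hcont
    refine ge_of_tendsto hcont ?_
    filter_upwards [self_mem_nhdsWithin] with δ hδ
    exact key δ (ne_of_gt hδ)
  have : c * ρ E < 1 * ρ E := ENNReal.mul_lt_mul_left h0 hfin hc
  rw [one_mul] at this
  exact absurd hlim (not_le.2 this)

/-! ### Canonical measures have no atoms -/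

lemma split (ν : Measure CS) (w : List (ZMod 2)) :
    ν (cyl w) = ν (cyl (w ++ [0])) + ν (cyl (w ++ [1])) := by
  rw [← measure_union _ (meas_cyl _)]
  · congr 1
    ext x
    simp only [mem_union, mem_cyl_snoc]
    have := zmod2 (x w.length)
    tauto
  · refine Set.disjoint_left.2 fun x hx hx' => ?_
    rw [mem_cyl_snoc] at hx hx'
    exact absurd (hx.2.symm.trans hx'.2) (by decide)

lemma half_of_branch {B : Set CS} {ν : Measure CS} (hν : IsCanonical B ν) {w : List (ZMod 2)}
    (hw : Branch B w) (b : ZMod 2) : ν (cyl (w ++ [b])) = 2⁻¹ * ν (cyl w) := by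
  have h1 := split ν w
  have h2 := hν.2.2 w hw
  have h3 : ν (cyl w) = 2 * ν (cyl (w ++ [b])) := by
    rcases zmod2 b with rfl | rfl
    · rw [h1, ← h2, two_mul]
    · rw [h1, h2, two_mul]
  rw [h3, ← mul_assoc, ENNReal.inv_mul_cancel (by simp) (by simp), one_mul]

lemma exists_branch {B : Set CS} (hB : PerfSet B) {x : CS} (hx : x ∈ B) (N : ℕ) :
    ∃ n ≥ N, Branch B (pre x n) := by
  have := accPt_iff_nhds.1 (hB.1.acc _ hx) (cyl (pre x N))
    ((isOpen_cyl _).mem_nhds (self_mem_pre _ _))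
  obtain ⟨y, ⟨hy, hyB⟩, hne⟩ := this
  rw [mem_cyl_pre] at hy
  have hex : ∃ n, y n ≠ x n := Function.ne_iff.1 hne
  classical
  let n := Nat.find hex
  have hn : y n ≠ x n := Nat.find_spec hex
  have hmin : ∀ i < n, y i = x i := fun i hi => not_not.1 (Nat.find_min hex hi)
  refine ⟨n, not_lt.1 fun h => hn (hy n h), ?_⟩
  have hx' : x ∈ cyl (pre x n ++ [x n]) := by
    rw [mem_cyl_snoc, pre_length]; exact ⟨self_mem_pre _ _, rfl⟩
  have hy' : y ∈ cyl (pre x n ++ [y n]) := by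
    rw [mem_cyl_snoc, pre_length, mem_cyl_pre]; exact ⟨hmin, rfl⟩
  rcases zmod2 (x n) with h | h <;> rcases zmod2 (y n) with h' | h'
  · exact absurd (h'.trans h.symm) hn
  · rw [h] at hx'; rw [h'] at hy'
    exact ⟨⟨x, hx', hx⟩, ⟨y, hy', hyB⟩⟩
  · rw [h] at hx'; rw [h'] at hy'
    exact ⟨⟨y, hy', hyB⟩, ⟨x, hx', hx⟩⟩
  · exact absurd (h'.trans h.symm) hn

lemma canon_compl {B : Set CS} (hB : PerfSet B) {ν : Measure CS} (hν : IsCanonical B ν) :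
    ν Bᶜ = 0 := by
  have := hν.1
  rw [prob_compl_eq_zero_iff hB.1.closed.measurableSet]
  exact hν.2.1

lemma canon_atomless {B : Set CS} (hB : PerfSet B) {ν : Measure CS} (hν : IsCanonical B ν)
    (x : CS) : ν {x} = 0 := by
  have := hν.1
  by_cases hx : x ∈ B
  · refine density ν {x} 2⁻¹ (by simp) {x} subset_rfl ?_
    rintro _ rfl N
    obtain ⟨n, hn, hb⟩ := exists_branch hB hx N
    refine ⟨n, hn, ?_⟩
    rw [← half_of_branch hν hb (_ : ZMod 2), ← pre_succ]
    refine measure_mono ?_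
    rintro _ ⟨_, rfl⟩
    exact self_mem_pre _ _
  · exact measure_mono_null (singleton_subset_iff.2 hx) (canon_compl hB hν)

/-! ### Branch counting -/

lemma brCount_snoc (P : Set CS) (u : List (ZMod 2)) (b : ZMod 2) :
    (Branch P u → brCount P (u ++ [b]) = brCount P u + 1) ∧
    (¬ Branch P u → brCount P (u ++ [b]) = brCount P u) := by
  have hiff : ∀ v : List (ZMod 2), (v <+: u ++ [b] ∧ v ≠ u ++ [b]) ↔ v <+: u := by
    intro v
    rw [List.prefix_concat_iff]
    constructor
    · rintro ⟨h | h, h2⟩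
      · exact absurd h h2
      · exact h
    · intro h
      refine ⟨Or.inr h, ?_⟩
      rintro rfl
      have := h.length_le
      simp at this
  have hset : {v : List (ZMod 2) | v <+: u ++ [b] ∧ v ≠ u ++ [b] ∧ Branch P v}
      = {v | v <+: u ∧ Branch P v} := by
    ext v
    simp only [mem_ofPred_eq, ← and_assoc, hiff]
  have hfin : {v : List (ZMod 2) | v <+: u ∧ v ≠ u ∧ Branch P v}.Finite := by
    refine (List.finite_toSet u.inits).subset ?_
    rintro v ⟨h, _⟩
    exact (List.mem_inits _ _).2 h
  unfold brCount
  rw [hset]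
  constructor
  · intro hb
    rw [← Set.ncard_insert_of_notMem (a := u) (by simp) hfin]
    congr 1
    ext v
    simp only [mem_ofPred_eq, mem_insert_iff]
    constructor
    · rintro ⟨h1, h2⟩
      by_cases h : v = u
      · exact Or.inl h
      · exact Or.inr ⟨h1, h, h2⟩
    · rintro (rfl | ⟨h1, _, h2⟩)
      · exact ⟨List.prefix_rfl, hb⟩
      · exact ⟨h1, h2⟩
  · intro hb
    congr 1
    ext v
    simp only [mem_ofPred_eq]
    constructor
    · rintro ⟨h1, h2⟩
      exact ⟨h1, by rintro rfl; exact hb h2, h2⟩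
    · rintro ⟨h1, _, h2⟩
      exact ⟨h1, h2⟩

/-! ### The perfect set supporting the two projections -/

/-- In each block of two coordinates the word `11` is forbidden. -/
def PP : Set CS := {x | ∀ k, x (2 * k) = 1 → x (2 * k + 1) = 0}

lemma closed_PP : IsClosed PP := by
  have : PP = ⋂ k, ({x : CS | x (2 * k) = 1}ᶜ ∪ {x : CS | x (2 * k + 1) = 1}ᶜ) := by
    ext x
    simp only [PP, mem_ofPred_eq, mem_iInter, mem_union, mem_compl_iff]
    refine forall_congr' fun k => ?_
    have h := zmod2 (x (2 * k + 1))
    have h01 : (0 : ZMod 2) ≠ 1 := by decide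
    constructor
    · intro h1
      by_cases h2 : x (2 * k) = 1
      · right; rw [h1 h2]; exact h01
      · left; exact h2
    · intro h1 h2
      rcases h1 with h1 | h1
      · exact absurd h2 h1
      · tauto
  rw [this]
  exact isClosed_iInter fun k =>
    (open_coord _ _).isClosed_compl.union (open_coord _ _).isClosed_compl

/-- The canonical measure of `PP`, described on blocks. -/
structure Good (l : Measure CS) : Prop where
  prob : IsProbabilityMeasure l
  compl : l PPᶜ = 0
  one : ∀ (w : List (ZMod 2)) (k : ℕ) (b : ZMod 2), w.length = 2 * k →
    l (cyl (w ++ [b])) = 2⁻¹ * l (cyl w)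
  two : ∀ (w : List (ZMod 2)) (k : ℕ) (b : ZMod 2), w.length = 2 * k →
    l (cyl (w ++ [0] ++ [b])) = 2⁻¹ * (2⁻¹ * l (cyl w))

lemma cyl_snoc_subset (w : List (ZMod 2)) (b : ZMod 2) : cyl (w ++ [b]) ⊆ cyl w := by
  rw [cyl_snoc]; exact inter_subset_left

lemma meets (ρ : Measure CS) [IsProbabilityMeasure ρ] {G : Set CS}
    {w v : List (ZMod 2)} (hvw : cyl v ⊆ cyl w) (h8 : 8⁻¹ * ρ (cyl w) ≤ ρ (cyl v))
    (hb : ¬ (ρ (cyl w ∩ G) ≤ (1 - 8⁻¹) * ρ (cyl w))) : (cyl v ∩ G).Nonempty := by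
  by_contra hne
  rw [Set.not_nonempty_iff_eq_empty] at hne
  apply hb
  rw [ENNReal.sub_mul (fun _ _ => measure_ne_top _ _), one_mul]
  calc ρ (cyl w ∩ G) ≤ ρ (cyl w \ cyl v) := by
        refine measure_mono fun x hx => ⟨hx.1, fun hv => ?_⟩
        have : x ∈ cyl v ∩ G := ⟨hv, hx.2⟩
        rw [hne] at this
        exact this
    _ = ρ (cyl w) - ρ (cyl v) :=
        measure_sdiff hvw (meas_cyl v).nullMeasurableSet (measure_ne_top _ _)
    _ ≤ _ := tsub_le_tsub_left h8 _

lemma half_le (a : ENNReal) : 2⁻¹ * a ≤ a := by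
  calc 2⁻¹ * a ≤ 1 * a := by gcongr; simp
    _ = a := one_mul a

lemma eighth (a : ENNReal) : 8⁻¹ * a = 2⁻¹ * (2⁻¹ * (2⁻¹ * a)) := by
  rw [← mul_assoc, ← mul_assoc]
  congr 1
  rw [← ENNReal.mul_inv (by simp) (by simp), ← ENNReal.mul_inv (by simp) (by simp)]
  norm_num

lemma node_contra {l ν : Measure CS} {B : Set CS} (hl : Good l) (hB : BalancedPerf B)
    (hν : IsCanonical B ν) (w : List (ZMod 2)) (k : ℕ) (hw : w.length = 2 * k)
    (h1 : ¬ (l (cyl w ∩ B) ≤ (1 - 8⁻¹) * l (cyl w)))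
    (h2 : ¬ (ν (cyl w ∩ PP) ≤ (1 - 8⁻¹) * ν (cyl w))) : False := by
  have := hl.prob
  have := hν.1
  have sub1 : ∀ a, cyl (w ++ [a]) ⊆ cyl w := fun a => cyl_snoc_subset w a
  have sub2 : ∀ a b, cyl (w ++ [a] ++ [b]) ⊆ cyl w := fun a b =>
    (cyl_snoc_subset _ b).trans (sub1 a)
  have sub3 : ∀ a b c, cyl (w ++ [a] ++ [b] ++ [c]) ⊆ cyl w := fun a b c =>
    (cyl_snoc_subset _ c).trans (sub2 a b)
  have m1 : ∀ a, (cyl (w ++ [a]) ∩ B).Nonempty := fun a => by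
    refine meets l (sub1 a) ?_ h1
    rw [hl.one w k a hw, eighth]
    exact (half_le _).trans (half_le _)
  have m2 : ∀ b, (cyl (w ++ [0] ++ [b]) ∩ B).Nonempty := fun b => by
    refine meets l (sub2 0 b) ?_ h1
    rw [hl.two w k b hw, eighth]
    exact half_le _
  have m3 : ∀ c, (cyl (w ++ [0] ++ [0] ++ [c]) ∩ B).Nonempty := fun c => by
    refine meets l (sub3 0 0 c) ?_ h1
    rw [hl.one (w ++ [0] ++ [0]) (k + 1) c (by simp [hw]; ring), hl.two w k 0 hw, eighth]
  have hno : ∀ x ∈ cyl (w ++ [1] ++ [1]), x ∉ PP := by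
    intro x hx hP
    rw [mem_cyl_snoc, mem_cyl_snoc, List.length_append, List.length_singleton, hw] at hx
    have := hP k hx.1.2
    rw [hx.2] at this
    exact absurd this (by decide)
  have h11 : l (cyl (w ++ [1] ++ [1])) = 0 := measure_mono_null hno hl.compl
  have h10 : l (cyl (w ++ [1] ++ [0])) = 2⁻¹ * l (cyl w) := by
    have := split l (w ++ [1])
    rw [h11, add_zero, hl.one w k 1 hw] at this
    exact this.symm
  have m3' : ∀ c, (cyl (w ++ [1] ++ [0] ++ [c]) ∩ B).Nonempty := fun c => by
    refine meets l (sub3 1 0 c) ?_ h1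
    rw [hl.one (w ++ [1] ++ [0]) (k + 1) c (by simp [hw]; ring), h10, eighth]
    exact half_le _
  have bw : Branch B w := ⟨m1 0, m1 1⟩
  have b0 : Branch B (w ++ [0]) := ⟨m2 0, m2 1⟩
  have b00 : Branch B (w ++ [0] ++ [0]) := ⟨m3 0, m3 1⟩
  have b10 : Branch B (w ++ [1] ++ [0]) := ⟨m3' 0, m3' 1⟩
  have nb1 : ¬ Branch B (w ++ [1]) := by
    intro hb
    have : (cyl (w ++ [1] ++ [1]) ∩ PP).Nonempty := by
      refine meets ν (sub2 1 1) ?_ h2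
      rw [half_of_branch hν hb, half_of_branch hν bw, eighth]
      exact half_le _
    obtain ⟨x, hx, hP⟩ := this
    exact hno x hx hP
  have c1 := (brCount_snoc B w 0).1 bw
  have c2 := (brCount_snoc B w 1).1 bw
  have c3 := (brCount_snoc B (w ++ [0]) 0).1 b0
  have c4 := (brCount_snoc B (w ++ [1]) 0).2 nb1
  have := hB.2 _ _ b10 b00 (by omega)
  simp at this

lemma sing {l ν : Measure CS} {B : Set CS} (hl : Good l) (hB : BalancedPerf B)
    (hν : IsCanonical B ν) : ∃ N, l N = 0 ∧ ν Nᶜ = 0 := by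
  have := hl.prob
  have := hν.1
  have hc : (1 - 8⁻¹ : ENNReal) < 1 := ENNReal.sub_lt_self (by simp) (by simp) (by simp)
  let N1 : Set CS := {x | x ∈ B ∧ ∀ N, ∃ n ≥ N,
    l (cyl (pre x n) ∩ B) ≤ (1 - 8⁻¹) * l (cyl (pre x n))}
  let N2 : Set CS := {x | x ∈ PP ∧ ∀ N, ∃ n ≥ N,
    ν (cyl (pre x n) ∩ PP) ≤ (1 - 8⁻¹) * ν (cyl (pre x n))}
  have z1 : l N1 = 0 := density l B _ hc N1 (fun x hx => hx.1) (fun x hx => hx.2)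
  have z2 : ν N2 = 0 := density ν PP _ hc N2 (fun x hx => hx.1) (fun x hx => hx.2)
  refine ⟨N1 ∪ PPᶜ, measure_union_null z1 hl.compl, ?_⟩
  refine measure_mono_null (t := N2 ∪ Bᶜ) ?_ (measure_union_null z2 (canon_compl hB.1 hν))
  intro x hx
  rw [mem_compl_iff, mem_union, not_or, mem_compl_iff, not_not] at hx
  obtain ⟨hx1, hxP⟩ := hx
  by_cases hxB : x ∈ B
  · left
    have h1 : ∃ N, ∀ n ≥ N, ¬ (l (cyl (pre x n) ∩ B) ≤ (1 - 8⁻¹) * l (cyl (pre x n))) := by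
      by_contra hcon
      push Not at hcon
      exact hx1 ⟨hxB, hcon⟩
    obtain ⟨M, hM⟩ := h1
    refine ⟨hxP, fun N => ⟨2 * (M + N), by omega, ?_⟩⟩
    by_contra hcon
    exact node_contra hl hB hν _ (M + N) (pre_length _ _) (hM _ (by omega)) hcon
  · right; exact hxB

lemma null_of_good {μ : Measure CS} {S : Set CS} (hS : Sierpinski μ S) {f : CS → CS}
    (hf : Measurable f) (hl : Good (μ.map f)) {B : Set CS} (hB : BalancedPerf B) :
    PNull B (f '' S) := by
  intro ν hν
  obtain ⟨N, hN, hNc⟩ := sing hl hB hν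
  have h0 : μ (f ⁻¹' N) = 0 := by
    have := le_antisymm ((Measure.le_map_apply hf.aemeasurable N).trans hN.le) (zero_le)
    exact this
  have hcount := (hS.2 _ h0).image f
  have : NullSingletonClass ν := ⟨canon_atomless hB.1 hν⟩
  refine measure_mono_null (t := f '' (S ∩ f ⁻¹' N) ∪ Nᶜ) ?_
    (measure_union_null (hcount.measure_zero ν) hNc)
  rintro _ ⟨⟨s, hs, rfl⟩, _⟩
  by_cases h : f s ∈ N
  · left; exact ⟨s, ⟨hs, h⟩, rfl⟩
  · right; exact h

/-! ### The fair coin measure -/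

lemma coin_half {μ : Measure CS} (hμ : IsFairCoin μ) (n : ℕ) (A : Set CS)
    (hA : ∀ x y : CS, (∀ i < n, x i = y i) → x ∈ A → y ∈ A) (b : ZMod 2) :
    μ (A ∩ {z | z n = b}) = 2⁻¹ * μ A := by
  let T : Set (List (ZMod 2)) := {w | w.length = n ∧ (cyl w ∩ A).Nonempty}
  have hsub : ∀ w ∈ T, cyl w ⊆ A := by
    rintro w ⟨hw, x, hx, hxA⟩ y hy
    refine hA x y (fun i hi => ?_) hxA
    rw [hx i (hw ▸ hi), hy i (hw ▸ hi)]
  have hAeq : A = ⋃ w ∈ T, cyl w := by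
    apply Set.Subset.antisymm
    · intro x hx
      exact mem_iUnion₂.2 ⟨pre x n, ⟨pre_length _ _, x, self_mem_pre _ _, hx⟩, self_mem_pre _ _⟩
    · exact iUnion₂_subset hsub
  have hAeq2 : A ∩ {z | z n = b} = ⋃ w ∈ T, cyl (w ++ [b]) := by
    conv_lhs => rw [hAeq]
    ext x
    simp only [mem_inter_iff, mem_iUnion, mem_cyl_snoc, mem_ofPred_eq]
    constructor
    · rintro ⟨⟨w, hw, hx⟩, h⟩
      exact ⟨w, hw, hx, by rw [hw.1]; exact h⟩
    · rintro ⟨w, hw, hx, h⟩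
      exact ⟨⟨w, hw, hx⟩, by rw [hw.1] at h; exact h⟩
  have hd : T.PairwiseDisjoint cyl := by
    intro w hw w' hw' hne
    refine Set.disjoint_left.2 fun z hz hz' => hne ?_
    rw [← pre_eq_of_mem hz, ← pre_eq_of_mem hz', hw.1, hw'.1]
  have hd2 : T.PairwiseDisjoint (fun w => cyl (w ++ [b])) := by
    intro w hw w' hw' hne
    exact (hd hw hw' hne).mono (cyl_snoc_subset _ _) (cyl_snoc_subset _ _)
  rw [hAeq2, measure_biUnion T.to_countable hd2 fun w _ => meas_cyl _]
  conv_rhs => rw [hAeq, measure_biUnion T.to_countable hd fun w _ => meas_cyl _]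
  rw [← ENNReal.tsum_mul_left]
  refine tsum_congr fun w => ?_
  rw [hμ.2, hμ.2, List.length_append, List.length_singleton, pow_succ, mul_comm]

/-- First projection of the coding. -/
def phi (z : CS) : CS := fun n =>
  if n % 2 = 0 then z n else if z (n - 1) = 0 then z n else 0

/-- Second projection of the coding. -/
def psi (z : CS) : CS := fun n =>
  if n % 2 = 0 then z (n + 1) else if z n = 0 then z (n - 1) else 0

lemma phi_even (z : CS) (k : ℕ) : phi z (2 * k) = z (2 * k) := by simp [phi]
lemma phi_odd (z : CS) (k : ℕ) :
    phi z (2 * k + 1) = if z (2 * k) = 0 then z (2 * k + 1) else 0 := by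
  simp [phi, Nat.add_mod]
lemma psi_even (z : CS) (k : ℕ) : psi z (2 * k) = z (2 * k + 1) := by simp [psi]
lemma psi_odd (z : CS) (k : ℕ) :
    psi z (2 * k + 1) = if z (2 * k + 1) = 0 then z (2 * k) else 0 := by
  simp [psi, Nat.add_mod]

lemma phi_dep {x y : CS} {k : ℕ} (h : ∀ i < 2 * k, x i = y i) :
    ∀ i < 2 * k, phi x i = phi y i := by
  intro i hi
  obtain ⟨j, rfl | rfl⟩ := Nat.even_or_odd' i
  · rw [phi_even, phi_even, h _ hi]
  · rw [phi_odd, phi_odd, h _ hi, h (2 * j) (by omega)]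

lemma psi_dep {x y : CS} {k : ℕ} (h : ∀ i < 2 * k, x i = y i) :
    ∀ i < 2 * k, psi x i = psi y i := by
  intro i hi
  obtain ⟨j, rfl | rfl⟩ := Nat.even_or_odd' i
  · rw [psi_even, psi_even, h _ (by omega)]
  · rw [psi_odd, psi_odd, h _ hi, h (2 * j) (by omega)]

lemma cont_ite {f g : CS → ZMod 2} (hf : Continuous f) (hg : Continuous g) :
    Continuous (fun z => if f z = 0 then g z else 0) := by
  have : (fun z => if f z = 0 then g z else 0) =
      (fun p : ZMod 2 × ZMod 2 => if p.1 = 0 then p.2 else 0) ∘ fun z => (f z, g z) := rfl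
  rw [this]
  exact continuous_of_discreteTopology.comp (hf.prodMk hg)

lemma cont_phi : Continuous phi := by
  refine continuous_pi fun n => ?_
  unfold phi
  by_cases h : n % 2 = 0
  · simp only [h, if_true]; exact continuous_apply n
  · simp only [h, if_false]; exact cont_ite (continuous_apply _) (continuous_apply _)

lemma cont_psi : Continuous psi := by
  refine continuous_pi fun n => ?_
  unfold psi
  by_cases h : n % 2 = 0
  · simp only [h, if_true]; exact continuous_apply _
  · simp only [h, if_false]; exact cont_ite (continuous_apply _) (continuous_apply _)

lemma cyl_dep {f : CS → CS} {w : List (ZMod 2)}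
    {m : ℕ} (hf : ∀ x y : CS, (∀ i < m, x i = y i) → ∀ i < w.length, f x i = f y i) :
    ∀ x y : CS, (∀ i < m, x i = y i) → x ∈ f ⁻¹' cyl w → y ∈ f ⁻¹' cyl w := by
  intro x y h hx i hi
  rw [← hf x y h i hi]
  exact hx i hi

lemma good_phi {μ : Measure CS} (hμ : IsFairCoin μ) : Good (μ.map phi) := by
  have := hμ.1
  have hm := cont_phi.measurable
  refine ⟨Measure.isProbabilityMeasure_map hm.aemeasurable, ?_, ?_, ?_⟩
  · rw [Measure.map_apply hm closed_PP.measurableSet.compl]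
    convert measure_empty (μ := μ)
    rw [Set.eq_empty_iff_forall_notMem]
    intro z hz
    apply hz
    intro k hk
    rw [phi_even] at hk
    rw [phi_odd, hk]
    simp
  · intro w k b hw
    rw [Measure.map_apply hm (meas_cyl _), Measure.map_apply hm (meas_cyl _)]
    have dep := cyl_dep (f := phi) (w := w) (m := 2 * k)
      (fun x y h => by rw [hw]; exact phi_dep h)
    rw [← coin_half hμ (2 * k) _ dep b]
    congr 1
    ext z
    simp only [mem_preimage, mem_cyl_snoc, mem_inter_iff, mem_ofPred_eq, hw, phi_even]
  · intro w k b hw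
    rw [Measure.map_apply hm (meas_cyl _), Measure.map_apply hm (meas_cyl _)]
    have dep := cyl_dep (f := phi) (w := w) (m := 2 * k)
      (fun x y h => by rw [hw]; exact phi_dep h)
    rw [← coin_half hμ (2 * k) _ dep 0]
    rw [← coin_half hμ (2 * k + 1) _ _ b]
    · congr 1
      ext z
      simp only [mem_preimage, mem_cyl_snoc, mem_inter_iff, mem_ofPred_eq, hw, phi_even,
        List.length_append, List.length_singleton, phi_odd]
      refine and_congr_right fun h => ?_
      rw [h.2]; simp
    · rintro x y h ⟨hx, hx2⟩
      refine ⟨dep x y (fun i hi => h i (by omega)) hx, ?_⟩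
      have e := h (2 * k) (by omega)
      exact e.symm.trans hx2

lemma good_psi {μ : Measure CS} (hμ : IsFairCoin μ) : Good (μ.map psi) := by
  have := hμ.1
  have hm := cont_psi.measurable
  refine ⟨Measure.isProbabilityMeasure_map hm.aemeasurable, ?_, ?_, ?_⟩
  · rw [Measure.map_apply hm closed_PP.measurableSet.compl]
    convert measure_empty (μ := μ)
    rw [Set.eq_empty_iff_forall_notMem]
    intro z hz
    apply hz
    intro k hk
    rw [psi_even] at hk
    rw [psi_odd, hk]
    simp
  · intro w k b hw
    rw [Measure.map_apply hm (meas_cyl _), Measure.map_apply hm (meas_cyl _)]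
    have dep := cyl_dep (f := psi) (w := w) (m := 2 * k)
      (fun x y h => by rw [hw]; exact psi_dep h)
    rw [← coin_half hμ (2 * k + 1) _ (fun x y h => dep x y (fun i hi => h i (by omega))) b]
    congr 1
    ext z
    simp only [mem_preimage, mem_cyl_snoc, mem_inter_iff, mem_ofPred_eq, hw, psi_even]
  · intro w k b hw
    rw [Measure.map_apply hm (meas_cyl _), Measure.map_apply hm (meas_cyl _)]
    have dep := cyl_dep (f := psi) (w := w) (m := 2 * k)
      (fun x y h => by rw [hw]; exact psi_dep h)
    rw [← coin_half hμ (2 * k) _ dep b]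
    rw [← coin_half hμ (2 * k + 1) _ _ 0]
    · congr 1
      ext z
      simp only [mem_preimage, mem_cyl_snoc, mem_inter_iff, mem_ofPred_eq, hw, psi_even,
        List.length_append, List.length_singleton, psi_odd]
      constructor
      · rintro ⟨⟨h1, h2⟩, h3⟩
        rw [h2] at h3
        exact ⟨⟨h1, by simpa using h3⟩, h2⟩
      · rintro ⟨⟨h1, h2⟩, h3⟩
        rw [h3]
        exact ⟨⟨h1, rfl⟩, by simpa using h2⟩
    · rintro x y h ⟨hx, hx2⟩
      refine ⟨dep x y (fun i hi => h i (by omega)) hx, ?_⟩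
      have e := h (2 * k) (by omega)
      exact e.symm.trans hx2

/-! ### The uniformly perfect set -/

/-- The coding map whose range is the uniformly perfect set. -/
def Theta (z : CS) : CS := interleave (phi z, psi z)

lemma theta0 (z : CS) (k : ℕ) : Theta z (4 * k) = z (2 * k) := by
  have h1 : (4 * k) % 2 = 0 := by omega
  have h2 : (4 * k) / 2 = 2 * k := by omega
  simp only [Theta, interleave, h1, h2, if_true, phi_even]

lemma theta1 (z : CS) (k : ℕ) : Theta z (4 * k + 1) = z (2 * k + 1) := by
  have h1 : ¬ (4 * k + 1) % 2 = 0 := by omega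
  have h2 : (4 * k + 1) / 2 = 2 * k := by omega
  simp only [Theta, interleave, h1, h2, if_false, psi_even]

lemma theta2 (z : CS) (k : ℕ) :
    Theta z (4 * k + 2) = if z (2 * k) = 0 then z (2 * k + 1) else 0 := by
  have h1 : (4 * k + 2) % 2 = 0 := by omega
  have h2 : (4 * k + 2) / 2 = 2 * k + 1 := by omega
  simp only [Theta, interleave, h1, h2, if_true, phi_odd]

lemma theta3 (z : CS) (k : ℕ) :
    Theta z (4 * k + 3) = if z (2 * k + 1) = 0 then z (2 * k) else 0 := by
  have h1 : ¬ (4 * k + 3) % 2 = 0 := by omega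
  have h2 : (4 * k + 3) / 2 = 2 * k + 1 := by omega
  simp only [Theta, interleave, h1, h2, if_false, psi_odd]

lemma theta_br (z : CS) (k r : ℕ) (hr : r < 2) : Theta z (4 * k + r) = z (2 * k + r) := by
  interval_cases r
  · exact theta0 z k
  · exact theta1 z k

lemma mod4 (n : ℕ) : ∃ k r, r < 4 ∧ n = 4 * k + r := ⟨n / 4, n % 4, by omega, by omega⟩

lemma theta_dep {x y : CS} {k r : ℕ} (hr : r < 2) (h : ∀ i < 2 * k + r, x i = y i) :
    ∀ i < 4 * k + r, Theta x i = Theta y i := by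
  intro i hi
  obtain ⟨j, s, hs, rfl⟩ := mod4 i
  have hj : j ≤ k := by omega
  interval_cases s
  · rw [theta_br _ _ 0 (by omega), theta_br _ _ 0 (by omega), h _ (by omega)]
  · rw [theta_br _ _ 1 (by omega), theta_br _ _ 1 (by omega), h _ (by omega)]
  · rw [theta2, theta2, h (2 * j) (by omega), h (2 * j + 1) (by omega)]
  · rw [theta3, theta3, h (2 * j) (by omega), h (2 * j + 1) (by omega)]

lemma cont_theta : Continuous Theta := by
  refine continuous_pi fun n => ?_
  unfold Theta interleave
  by_cases h : n % 2 = 0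
  · simp only [h, if_true]; exact (continuous_apply (n / 2)).comp cont_phi
  · simp only [h, if_false]; exact (continuous_apply (n / 2)).comp cont_psi

lemma theta_inj : Function.Injective Theta := by
  intro x y h
  funext i
  obtain ⟨j, rfl | rfl⟩ := Nat.even_or_odd' i
  · rw [← theta0 x, ← theta0 y, h]
  · rw [← theta1 x, ← theta1 y, h]

lemma perf_U : PerfSet (range Theta) := by
  refine ⟨⟨(isCompact_range cont_theta).isClosed, ?_⟩, range_nonempty _⟩
  rintro _ ⟨z, rfl⟩
  rw [accPt_iff_nhds]
  intro V hV
  have hV' := cont_theta.continuousAt.preimage_mem_nhds hV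
  obtain ⟨O, hOV, hO, hz⟩ := mem_nhds_iff.1 hV'
  obtain ⟨N, hN⟩ := cyl_subset_of_isOpen hO hz
  let z' : CS := Function.update z N (z N + 1)
  have hz' : z' ∈ cyl (pre z N) := by
    rw [mem_cyl_pre]
    intro i hi
    exact Function.update_of_ne (by omega) _ _
  refine ⟨Theta z', ⟨hOV (hN N le_rfl hz'), mem_range_self _⟩, ?_⟩
  intro h
  have := congrFun (theta_inj h) N
  simp [z'] at this

lemma U_branch (k r : ℕ) (hr : r < 2) (w : List (ZMod 2)) (hw : w.length = 4 * k + r)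
    (hne : (cyl w ∩ range Theta).Nonempty) : Branch (range Theta) w := by
  obtain ⟨_, hx, z, rfl⟩ := hne
  have key : ∀ b, (cyl (w ++ [b]) ∩ range Theta).Nonempty := by
    intro b
    let z' : CS := Function.update z (2 * k + r) b
    refine ⟨Theta z', ?_, mem_range_self _⟩
    rw [mem_cyl_snoc, hw, theta_br _ _ _ hr]
    refine ⟨fun i hi => ?_, by simp [z']⟩
    rw [← hx i hi]
    refine theta_dep hr (fun i hi => ?_) i (hw ▸ hi)
    exact Function.update_of_ne (by omega) _ _
  exact ⟨key 0, key 1⟩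

lemma U_nobranch (k r : ℕ) (hr : r < 4) (hr2 : 2 ≤ r) (w : List (ZMod 2))
    (hw : w.length = 4 * k + r) : ¬ Branch (range Theta) w := by
  rintro ⟨⟨_, hx, x, rfl⟩, ⟨_, hy, y, rfl⟩⟩
  rw [mem_cyl_snoc, hw] at hx hy
  have e : ∀ i < 4 * k + r, Theta x i = Theta y i := fun i hi => by
    rw [hx.1 i (hw ▸ hi), hy.1 i (hw ▸ hi)]
  have e0 := e (4 * k) (by omega)
  have e1 := e (4 * k + 1) (by omega)
  rw [theta0, theta0] at e0
  rw [theta1, theta1] at e1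
  have h01 : Theta x (4 * k + r) = Theta y (4 * k + r) := by
    interval_cases r
    · rw [theta2, theta2, e0, e1]
    · rw [theta3, theta3, e0, e1]
  rw [hx.2, hy.2] at h01
  exact absurd h01 (by decide)

lemma unif_U : UniformlyPerf (range Theta) := by
  refine ⟨perf_U, fun n => ?_⟩
  obtain ⟨k, r, hr, rfl⟩ := mod4 n
  by_cases h : r < 2
  · left; intro w hw hne; exact U_branch k r h w hw hne
  · right; intro w hw; exact U_nobranch k r hr (by omega) w hw

lemma canon_U {μ : Measure CS} (hμ : IsFairCoin μ) : IsCanonical (range Theta) (μ.map Theta) := by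
  have := hμ.1
  have hm := cont_theta.measurable
  refine ⟨Measure.isProbabilityMeasure_map hm.aemeasurable, ?_, ?_⟩
  · rw [Measure.map_apply hm perf_U.1.closed.measurableSet]
    simp
  · intro w hw
    obtain ⟨k, r, hr, hwl⟩ := mod4 w.length
    have hr2 : r < 2 := by
      by_contra h
      exact U_nobranch k r hr (by omega) w hwl hw
    have dep := cyl_dep (f := Theta) (w := w) (m := 2 * k + r)
      (fun x y h => by rw [hwl]; exact theta_dep hr2 h)
    have key : ∀ b, (μ.map Theta) (cyl (w ++ [b])) = 2⁻¹ * μ (Theta ⁻¹' cyl w) := by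
      intro b
      rw [Measure.map_apply hm (meas_cyl _), ← coin_half hμ (2 * k + r) _ dep b]
      congr 1
      ext z
      simp only [mem_preimage, mem_cyl_snoc, mem_inter_iff, mem_ofPred_eq, hwl,
        theta_br _ _ _ hr2]
    rw [key, key]

/-- If there exists a Sierpiński set, then there are `X, Y ∈ bPN` with
`h[X × Y] ∉ uPN`. -/
theorem stmt_14 (μ : Measure CS) (hμ : IsFairCoin μ) (S : Set CS) (hS : Sierpinski μ S) :
    ∃ X Y : Set CS, (∀ B, BalancedPerf B → PNull B X) ∧
      (∀ B, BalancedPerf B → PNull B Y) ∧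
      ∃ U, UniformlyPerf U ∧ ¬ PNull U (interleave '' (X ×ˢ Y)) := by
  refine ⟨phi '' S, psi '' S, fun B hB => null_of_good hS cont_phi.measurable (good_phi hμ) hB,
    fun B hB => null_of_good hS cont_psi.measurable (good_psi hμ) hB, range Theta, unif_U, ?_⟩
  intro hnull
  have h0 := hnull _ (canon_U hμ)
  have h1 : μ (Theta ⁻¹' (interleave '' ((phi '' S) ×ˢ (psi '' S)) ∩ range Theta)) = 0 :=
    le_antisymm ((Measure.le_map_apply cont_theta.measurable.aemeasurable _).trans h0.le) zero_le
  refine hS.1 ((hS.2 _ h1).mono ?_)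
  intro s hs
  refine ⟨hs, ?_, mem_range_self _⟩
  exact ⟨(phi s, psi s), ⟨mem_image_of_mem _ hs, mem_image_of_mem _ hs⟩, rfl⟩
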